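/- Let (Z_j)_{j=1}^N be independent standard Gaussian random variables, and let q, b₁, …, b_N ∈ ℝ be numbers with (1/N)·Σ_{j=1}^N b_j ≤ q. Then ℙ(Z_j + b_j ≥ 0 for all 1 ≤ j ≤ N) ≤ ℙ(Z₁ ≤ q)^N. Equivalently, with Φ the standard Gaussian cumulative distribution function, ∏_{j=1}^N Φ(b_j) ≤ Φ(q)^N. -/

import Mathlib

open MeasureTheory ProbabilityTheory Real Set

noncomputable def gPhi (x : ℝ) : ℝ := (gaussianReal 0 1 (Set.Iic x)).toReal

lemma gPhi_eq (x : ℝ) : gPhi x = ∫ t in Iic x, gaussianPDFReal 0 1 t := by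
  unfold gPhi
  rw [gaussianReal_apply_eq_integral 0 one_ne_zero, ENNReal.toReal_ofReal]
  exact integral_nonneg (fun t => gaussianPDFReal_nonneg 0 1 t)

lemma gPhi_eq_shift (x : ℝ) : gPhi x = ∫ t in Iic 0, gaussianPDFReal (-x) 1 t := by
  have h := gaussianReal_map_sub_const (μ := 0) (v := 1) x
  rw [zero_sub] at h
  have h2 : gaussianReal 0 1 (Iic x) = gaussianReal (-x) 1 (Iic 0) := by
    rw [← h, Measure.map_apply (by fun_prop) measurableSet_Iic]
    congr 1
    ext t
    simp
  unfold gPhi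
  rw [h2, gaussianReal_apply_eq_integral (-x) one_ne_zero, ENNReal.toReal_ofReal]
  exact integral_nonneg (fun t => gaussianPDFReal_nonneg _ 1 t)

lemma gPhi_pos (x : ℝ) : 0 < gPhi x := by
  unfold gPhi
  refine ENNReal.toReal_pos ?_ (measure_ne_top _ _)
  intro h
  have := gaussianReal_absolutelyContinuous' 0 (v := 1) one_ne_zero h
  simp at this

lemma gpdf_cont : Continuous (gaussianPDFReal 0 1) := by
  unfold gaussianPDFReal
  fun_prop

lemma gPhi_hasDerivAt (x : ℝ) : HasDerivAt gPhi (gaussianPDFReal 0 1 x) x := by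
  have hi := integrable_gaussianPDFReal 0 1
  have h : gPhi = fun x => gPhi 0 + ∫ t in (0:ℝ)..x, gaussianPDFReal 0 1 t := by
    funext y
    rw [← intervalIntegral.integral_Iic_sub_Iic hi.integrableOn hi.integrableOn,
      gPhi_eq, gPhi_eq]
    ring
  rw [h]
  exact (intervalIntegral.integral_hasDerivAt_right hi.intervalIntegrable
    (gpdf_cont.stronglyMeasurableAtFilter _ _) gpdf_cont.continuousAt).const_add _

lemma hazard (x y : ℝ) (h : x ≤ y) :
    gaussianPDFReal 0 1 y * gPhi x ≤ gaussianPDFReal 0 1 x * gPhi y := by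
  rw [gPhi_eq_shift, gPhi_eq_shift, ← integral_const_mul, ← integral_const_mul]
  refine setIntegral_mono_on ((integrable_gaussianPDFReal _ 1).const_mul _).integrableOn
    ((integrable_gaussianPDFReal _ 1).const_mul _).integrableOn measurableSet_Iic ?_
  intro t ht
  have ht : t ≤ 0 := ht
  simp only [gaussianPDFReal]
  rw [mul_mul_mul_comm, ← Real.exp_add, mul_mul_mul_comm _ (rexp (-(x - 0) ^ 2 / _)), ← Real.exp_add]
  refine mul_le_mul_of_nonneg_left (Real.exp_le_exp.2 ?_) (by positivity)
  simp only [NNReal.coe_one]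
  nlinarith [mul_nonneg (sub_nonneg.2 h) (neg_nonneg.2 ht)]

lemma log_gPhi_concave : ConcaveOn ℝ univ (fun x => Real.log (gPhi x)) := by
  have hd : ∀ x, HasDerivAt (fun x => Real.log (gPhi x)) (gaussianPDFReal 0 1 x / gPhi x) x :=
    fun x => (gPhi_hasDerivAt x).log (gPhi_pos x).ne'
  refine Antitone.concaveOn_univ_of_deriv (fun x => (hd x).differentiableAt) ?_
  intro x y hxy
  rw [(hd x).deriv, (hd y).deriv, div_le_div_iff₀ (gPhi_pos y) (gPhi_pos x)]
  exact hazard x y hxy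

lemma gPhi_mono : Monotone gPhi := fun _ _ h =>
  ENNReal.toReal_mono (measure_ne_top _ _) (measure_mono (Iic_subset_Iic.2 h))

lemma prod_gPhi_le (N : ℕ) (b : Fin N → ℝ) (q : ℝ) (havg : (1 / (N : ℝ)) * ∑ j, b j ≤ q) :
    ∏ j, gPhi (b j) ≤ gPhi q ^ N := by
  rcases Nat.eq_zero_or_pos N with rfl | hN
  · simp
  have hN' : (0 : ℝ) < N := by exact_mod_cast hN
  have hj := log_gPhi_concave.le_map_sum (t := Finset.univ) (w := fun _ : Fin N => 1 / (N : ℝ))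
    (p := b) (fun _ _ => by positivity) (by simp [hN'.ne']) (fun _ _ => mem_univ _)
  simp only [smul_eq_mul, ← Finset.mul_sum] at hj
  have h2 := hj.trans (Real.log_le_log (gPhi_pos _) (gPhi_mono havg))
  rw [← Real.log_le_log_iff (Finset.prod_pos fun j _ => gPhi_pos _) (pow_pos (gPhi_pos _) _),
    Real.log_prod (fun j _ => (gPhi_pos _).ne'), Real.log_pow]
  rwa [one_div, inv_mul_le_iff₀ hN'] at h2

theorem statement19 (Ω : Type*) [MeasurableSpace Ω] (P : Measure Ω)
    [IsProbabilityMeasure P] (N : ℕ) (Z : Fin N → Ω → ℝ) (b : Fin N → ℝ) (q : ℝ)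
    (hmeas : ∀ j, Measurable (Z j))
    (hindep : iIndepFun Z P)
    (hlaw : ∀ j, P.map (Z j) = gaussianReal 0 1)
    (havg : (1 / (N : ℝ)) * ∑ j, b j ≤ q) :
    P {ω | ∀ j, 0 ≤ Z j ω + b j} ≤ (gaussianReal 0 1 (Set.Iic q)) ^ N ∧
    ∏ j, (gaussianReal 0 1 (Set.Iic (b j))).toReal
      ≤ (gaussianReal 0 1 (Set.Iic q)).toReal ^ N := by
  have key := prod_gPhi_le N b q havg
  refine ⟨?_, key⟩
  have h1 : {ω | ∀ j, 0 ≤ Z j ω + b j} = ⋂ j ∈ Finset.univ, Z j ⁻¹' (Ici (-b j)) := by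
    ext ω
    simp [neg_le_iff_add_nonneg]
  have h3 : ∀ c : ℝ, gaussianReal 0 1 (Ici (-c)) = gaussianReal 0 1 (Iic c) := by
    intro c
    have h := gaussianReal_map_neg (μ := 0) (v := 1)
    rw [neg_zero] at h
    conv_lhs => rw [← h]
    rw [Measure.map_apply (by fun_prop) measurableSet_Ici]
    congr 1
    ext t
    simp
  have h2 : ∀ j, P (Z j ⁻¹' (Ici (-b j))) = gaussianReal 0 1 (Iic (b j)) := by
    intro j
    rw [← Measure.map_apply (hmeas j) measurableSet_Ici, hlaw j, h3]
  rw [h1, hindep.measure_inter_preimage_eq_mul Finset.univ (fun j _ => measurableSet_Ici),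
    Finset.prod_congr rfl (fun j _ => h2 j)]
  rw [← ENNReal.toReal_le_toReal (ENNReal.prod_ne_top fun _ _ => measure_ne_top _ _)
    (ENNReal.pow_ne_top (measure_ne_top _ _)), ENNReal.toReal_prod, ENNReal.toReal_pow]
  exact key
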